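/- arXiv:2408.03743 — 3 statements merged into one kernel-verified Lean document; each statement's English description precedes it below -/
import Mathlib

section
/- For any Fano plane F, there exist exactly eight Fano planes on the same point set that are orthogonal to F. -/
/-- A Steiner triple system: every block has 3 points and every pair of
distinct points lies in exactly one block. -/
def IsSteiner {V : Type*} [DecidableEq V] (B : Finset (Finset V)) : Prop :=
  (∀ b ∈ B, b.card = 3) ∧
  ∀ x y : V, x ≠ y → ∃! b : Finset V, b ∈ B ∧ x ∈ b ∧ y ∈ b

/-- A Fano plane: a Steiner triple system on a 7-point set. -/
def IsFano {V : Type*} [DecidableEq V] [Fintype V] (B : Finset (Finset V)) : Prop :=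
  Fintype.card V = 7 ∧ IsSteiner B

/-- Two systems on the same point set are disjoint if they share no block. -/
def DisjointSTS {V : Type*} [DecidableEq V] (B1 B2 : Finset (Finset V)) : Prop :=
  ∀ b : Finset V, ¬ (b ∈ B1 ∧ b ∈ B2)

/-- Orthogonality of two Steiner triple systems: disjoint, and two distinct
pairs lying in blocks of the first system with a common third point never have
the same third point in the second system. -/
def OrthogonalSTS {V : Type*} [DecidableEq V] (B1 B2 : Finset (Finset V)) : Prop :=
  DisjointSTS B1 B2 ∧
  ∀ x y z u v a b : V, ({x, y} : Finset V) ≠ ({u, v} : Finset V) →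
    ({x, y, z} : Finset V) ∈ B1 → ({u, v, z} : Finset V) ∈ B1 →
    ({x, y, a} : Finset V) ∈ B2 → ({u, v, b} : Finset V) ∈ B2 → a ≠ b

section Steiner

variable {V : Type*} [DecidableEq V] {B C : Finset (Finset V)}

namespace IsSteiner

lemma ne_of_mem (h : IsSteiner B) {x y z : V} (hb : {x, y, z} ∈ B) :
    x ≠ y ∧ x ≠ z ∧ y ≠ z :=
  Finset.card_triple_eq_three_iff.1 (h.1 _ hb)

lemma eq_of_mem (h : IsSteiner B) {b c : Finset V} (hb : b ∈ B) (hc : c ∈ B) {x y : V}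
    (hxy : x ≠ y) (hxb : x ∈ b) (hyb : y ∈ b) (hxc : x ∈ c) (hyc : y ∈ c) : b = c :=
  (h.2 x y hxy).unique ⟨hb, hxb, hyb⟩ ⟨hc, hxc, hyc⟩

lemma third_unique (h : IsSteiner B) {x y z w : V} (hz : {x, y, z} ∈ B)
    (hw : {x, y, w} ∈ B) : z = w := by
  have hne := h.ne_of_mem hz
  have heq := h.eq_of_mem hz hw hne.1 (by simp) (by simp) (by simp) (by simp)
  have hmem : z ∈ ({x, y, w} : Finset V) := heq ▸ (by simp)
  simp only [Finset.mem_insert, Finset.mem_singleton] at hmem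
  grind

lemma exists_third (h : IsSteiner B) {x y : V} (hxy : x ≠ y) : ∃ z, {x, y, z} ∈ B := by
  obtain ⟨b, ⟨hb, hx, hy⟩, -⟩ := h.2 x y hxy
  have hsub : ({x, y} : Finset V) ⊆ b := by grind
  obtain ⟨z, hz, rfl⟩ := (Finset.exists_eq_insert_iff (s := {x, y}) (t := b)).2
    ⟨hsub, by rw [h.1 b hb, Finset.card_pair hxy]⟩
  refine ⟨z, ?_⟩
  convert hb using 1
  grind

lemma eq_of_subset (hB : IsSteiner B) (hC : IsSteiner C) (hCB : C ⊆ B) : C = B := by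
  refine hCB.antisymm fun b hb => ?_
  obtain ⟨x, hx, y, hy, hxy⟩ := Finset.one_lt_card.1 (by rw [hB.1 b hb]; norm_num)
  obtain ⟨c, ⟨hc, hxc, hyc⟩, -⟩ := hC.2 x y hxy
  rwa [hB.eq_of_mem hb (hCB hc) hxy hx hy hxc hyc]

end IsSteiner

lemma insert_left_comm_mem {x y z : V} (h : {x, y, z} ∈ B) : {y, x, z} ∈ B := by
  rwa [Finset.insert_comm]

lemma insert_right_comm_mem {x y z : V} (h : {x, y, z} ∈ B) : {x, z, y} ∈ B := by
  rwa [Finset.pair_comm]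

/-- The Fano plane labelled by `p`. -/
def fano (p : Fin 7 → V) : Finset (Finset V) :=
  {{p 0, p 1, p 2}, {p 0, p 3, p 4}, {p 1, p 3, p 5}, {p 2, p 3, p 6},
    {p 0, p 5, p 6}, {p 1, p 4, p 6}, {p 2, p 4, p 5}}

lemma image_fano {W : Type*} [DecidableEq W] (e : V → W) (p : Fin 7 → V) :
    (fano p).image (Finset.image e) = fano (e ∘ p) := by
  simp [fano, Finset.image_insert]

set_option maxRecDepth 10000 in
lemma isSteiner_fano_id : IsSteiner (fano (id : Fin 7 → Fin 7)) := by
  refine ⟨by decide, fun x y hxy => ?_⟩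
  have hex : ∀ x y : Fin 7, x ≠ y → ∃ b ∈ fano (id : Fin 7 → Fin 7), x ∈ b ∧ y ∈ b := by
    decide
  have huniq : ∀ b ∈ fano (id : Fin 7 → Fin 7), ∀ c ∈ fano (id : Fin 7 → Fin 7), b ≠ c →
      (b ∩ c).card ≤ 1 := by
    decide
  obtain ⟨b, hb, hx, hy⟩ := hex x y hxy
  refine ⟨b, ⟨hb, hx, hy⟩, fun c ⟨hc, hxc, hyc⟩ => ?_⟩
  by_contra hcb
  exact hxy (Finset.card_le_one.1 (huniq c hc b hb hcb) x (by simp [*]) y (by simp [*]))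

lemma IsSteiner.image_equiv {W : Type*} [DecidableEq W] (h : IsSteiner B) (e : V ≃ W) :
    IsSteiner (B.image (Finset.image e)) := by
  refine ⟨?_, fun x y hxy => ?_⟩
  · simp only [Finset.mem_image, forall_exists_index, and_imp, forall_apply_eq_imp_iff₂]
    intro b hb
    rw [Finset.card_image_of_injective _ e.injective, h.1 b hb]
  · obtain ⟨b, ⟨hb, hx, hy⟩, hu⟩ := h.2 (e.symm x) (e.symm y) (by simpa using hxy)
    refine ⟨b.image e, ⟨Finset.mem_image_of_mem _ hb, ?_, ?_⟩, ?_⟩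
    · exact Finset.mem_image.2 ⟨_, hx, by simp⟩
    · exact Finset.mem_image.2 ⟨_, hy, by simp⟩
    · rintro c ⟨hc, hxc, hyc⟩
      obtain ⟨d, hd, rfl⟩ := Finset.mem_image.1 hc
      rw [hu d ⟨hd, ?_, ?_⟩]
      · obtain ⟨v, hv, rfl⟩ := Finset.mem_image.1 hxc
        simpa using hv
      · obtain ⟨v, hv, rfl⟩ := Finset.mem_image.1 hyc
        simpa using hv

lemma isSteiner_fano (e : Fin 7 ≃ V) : IsSteiner (fano e) := by
  simpa [image_fano] using isSteiner_fano_id.image_equiv e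

end Steiner

section Fano

variable {V : Type*} [DecidableEq V] [Fintype V] {B C : Finset (Finset V)}

/-- A Fano plane can be labelled with two prescribed points as the first two labels. -/
lemma IsFano.exists_eq_fano (hB : IsFano B) {a b : V} (hab : a ≠ b) :
    ∃ p : Fin 7 ≃ V, p 0 = a ∧ p 1 = b ∧ B = fano p := by
  obtain ⟨hV, h⟩ := hB
  have hne := @h.ne_of_mem
  have hu := @h.third_unique
  have hl := @insert_left_comm_mem V _ B
  have hr := @insert_right_comm_mem V _ B
  obtain ⟨c, hc⟩ := h.exists_third hab
  obtain ⟨d, hd⟩ : ∃ d, d ∉ ({a, b, c} : Finset V) := by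
    by_contra! hall
    have hle := Finset.card_le_card (fun v _ => hall v : Finset.univ ⊆ _)
    rw [h.1 _ hc, Finset.card_univ, hV] at hle
    omega
  simp only [Finset.mem_insert, Finset.mem_singleton, not_or] at hd
  obtain ⟨hda, hdb, hdc⟩ := hd
  obtain ⟨e, he⟩ := h.exists_third (Ne.symm hda)
  obtain ⟨f, hf⟩ := h.exists_third (Ne.symm hdb)
  obtain ⟨g, hg⟩ := h.exists_third (Ne.symm hdc)
  generalize hT : (fun x y z : V => ({x, y, z} : Finset V) ∈ B) = T
  replace hT : ∀ x y z, ({x, y, z} : Finset V) ∈ B ↔ T x y z := by simp [← hT]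
  have hex := @h.exists_third
  simp only [hT] at hne hu hl hr hc he hf hg hex
  have hinj : Function.Injective ![a, b, c, d, e, f, g] := by
    have : [a, b, c, d, e, f, g].Nodup := by
      simp only [List.nodup_cons, List.mem_cons, List.not_mem_nil, or_false, not_or]
      grind
    exact List.nodup_ofFn.1 (by simpa using this)
  have hbij := (Fintype.bijective_iff_injective_and_card _).2 ⟨hinj, by simp [hV]⟩
  have hcov : ∀ v, v = a ∨ v = b ∨ v = c ∨ v = d ∨ v = e ∨ v = f ∨ v = g := by
    intro v
    obtain ⟨i, rfl⟩ := hbij.2 v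
    fin_cases i <;> simp
  have hafg : T a f g := by
    obtain ⟨v, hv⟩ := @hex a f (by grind)
    have := hcov v
    grind
  have hbeg : T b e g := by
    obtain ⟨v, hv⟩ := @hex b e (by grind)
    have := hcov v
    grind
  have hcef : T c e f := by
    obtain ⟨v, hv⟩ := @hex c e (by grind)
    have := hcov v
    grind
  refine ⟨Equiv.ofBijective _ hbij, rfl, rfl,
    (h.eq_of_subset (isSteiner_fano _) fun s hs => ?_).symm⟩
  simp only [fano, Finset.mem_insert, Finset.mem_singleton] at hs
  rcases hs with rfl | rfl | rfl | rfl | rfl | rfl | rfl <;> simpa [hT]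

/-- For Fano planes, orthogonality is the same as disjointness. -/
lemma IsFano.orthogonalSTS_iff (hB : IsFano B) (hC : IsFano C) :
    OrthogonalSTS B C ↔ DisjointSTS B C := by
  refine ⟨And.left, fun hd => ⟨hd, ?_⟩⟩
  rintro x y z u v a _ hxyuv hxyz huvz hxya huva rfl
  have hne := hB.2.ne_of_mem hxyz
  have hne' := hB.2.ne_of_mem huvz
  have hcne := hC.2.ne_of_mem hxya
  have hcne' := hC.2.ne_of_mem huva
  have hza : z ≠ a := by
    rintro rfl
    exact hd _ ⟨hxyz, hxya⟩
  have hdisj : x ≠ u ∧ x ≠ v ∧ y ≠ u ∧ y ≠ v := by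
    have key : ∀ w ∈ ({x, y} : Finset V), w ∉ ({u, v} : Finset V) := by
      intro w hw hw'
      have hwz : w ≠ z := by grind
      have heq := hB.2.eq_of_mem hxyz huvz hwz (by grind) (by simp) (by grind) (by simp)
      apply hxyuv
      have h₁ : ({x, y, z} : Finset V).erase z = {x, y} := by grind
      have h₂ : ({u, v, z} : Finset V).erase z = {u, v} := by grind
      rw [← h₁, heq, h₂]
    have hx := key x (by simp)
    have hy := key y (by simp)
    simp only [Finset.mem_insert, Finset.mem_singleton, not_or] at hx hy
    exact ⟨hx.1, hx.2, hy⟩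
  have hthird {D : Finset (Finset V)} (hD : IsFano D) {s t w : V}
      (hxys : {x, y, s} ∈ D) (huvs : {u, v, s} ∈ D)
      (hcov : ∀ r, r ∈ ({x, y, u, v, s, t, w} : Finset V))
      (hws : w ∉ ({x, y, u, v, s, t} : Finset V)) : {s, t, w} ∈ D := by
    have hu := @hD.2.third_unique
    have hn := @hD.2.ne_of_mem
    have hl := @insert_left_comm_mem V _ D
    have hr := @insert_right_comm_mem V _ D
    simp only [Finset.mem_insert, Finset.mem_singleton, not_or] at hcov hws
    obtain ⟨r, hrD⟩ := hD.2.exists_third (x := s) (y := w) (Ne.symm hws.2.2.2.2.1)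
    have hcovr := hcov r
    generalize hT : (fun x y z : V => ({x, y, z} : Finset V) ∈ D) = T
    replace hT : ∀ x y z, ({x, y, z} : Finset V) ∈ D ↔ T x y z := by simp [← hT]
    simp only [hT] at hxys huvs hu hn hl hr hrD ⊢
    grind
  have hcard : ({x, y, u, v, z, a} : Finset V).card = 6 := by
    repeat rw [Finset.card_insert_of_notMem (by grind)]
    simp
  obtain ⟨w, hw⟩ : ∃ w, w ∉ ({x, y, u, v, z, a} : Finset V) := by
    by_contra! hall
    have hle := Finset.card_le_card (fun v _ => hall v : Finset.univ ⊆ _)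
    rw [hcard, Finset.card_univ, hB.1] at hle
    omega
  have hcov : insert w ({x, y, u, v, z, a} : Finset V) = Finset.univ :=
    Finset.eq_univ_of_card _ (by rw [Finset.card_insert_of_notMem hw, hcard, hB.1])
  have hcov' (r : V) : r ∈ insert w ({x, y, u, v, z, a} : Finset V) := hcov ▸ Finset.mem_univ r
  refine hd {z, a, w} ⟨hthird hB hxyz huvz (fun r => ?_) hw,
    insert_left_comm_mem (hthird hC hxya huva (fun r => ?_) ?_)⟩
  · have := hcov' r
    grind
  · have := hcov' r
    grind
  · grind

end Fano

/-- Labellings of the eight Fano planes disjoint from the standard one. -/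
def disjointLabellings : List (Fin 7 → Fin 7) :=
  [![0, 1, 3, 2, 5, 6, 4], ![0, 1, 3, 2, 6, 4, 5], ![0, 1, 4, 2, 5, 3, 6],
    ![0, 1, 4, 2, 6, 5, 3], ![0, 1, 5, 2, 3, 4, 6], ![0, 1, 5, 2, 4, 6, 3],
    ![0, 1, 6, 2, 3, 5, 4], ![0, 1, 6, 2, 4, 3, 5]]

lemma card_image_fano_disjointLabellings : (disjointLabellings.map fano).toFinset.card = 8 := by
  decide +kernel

lemma injective_of_mem_disjointLabellings {q : Fin 7 → Fin 7} (hq : q ∈ disjointLabellings) :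
    Function.Injective q := by
  have h : disjointLabellings.all fun q => ∀ i j, q i = q j → i = j := by
    decide +kernel
  intro i j
  exact of_decide_eq_true (List.all_eq_true.1 h q hq) i j

lemma disjoint_of_mem_disjointLabellings {q : Fin 7 → Fin 7} (hq : q ∈ disjointLabellings) :
    Disjoint (fano (id : Fin 7 → Fin 7)) (fano q) := by
  have h : disjointLabellings.all fun q => Disjoint (fano (id : Fin 7 → Fin 7)) (fano q) := by
    decide +kernel
  exact of_decide_eq_true (List.all_eq_true.1 h q hq)

set_option synthInstance.maxSize 1000 in
lemma fano_mem_of_disjoint : ∀ c : Fin 7, c ∉ [0, 1] → ∀ d, d ∉ [0, 1, c] →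
    ∀ e, e ∉ [0, 1, c, d] → ∀ f, f ∉ [0, 1, c, d, e] → ∀ g, g ∉ [0, 1, c, d, e, f] →
    Disjoint (fano (id : Fin 7 → Fin 7)) (fano ![0, 1, c, d, e, f, g]) →
    fano ![0, 1, c, d, e, f, g] ∈ disjointLabellings.map fano := by
  decide +kernel

/-- There are exactly eight Fano planes orthogonal to a given Fano plane. -/
theorem eight_orthogonal_fano_planes {V : Type*} [DecidableEq V] [Fintype V]
    (B : Finset (Finset V)) (hB : IsFano B) :
    {B' : Finset (Finset V) | IsFano B' ∧ OrthogonalSTS B B'}.ncard = 8 := by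
  obtain ⟨e⟩ : Nonempty (Fin 7 ≃ V) := ⟨(Fintype.equivFinOfCardEq hB.1).symm⟩
  have h01 : (0 : Fin 7) ≠ 1 := by decide
  obtain ⟨p, -, -, rfl⟩ := hB.exists_eq_fano (e.injective.ne h01)
  have hinj : Function.Injective (Finset.image (Finset.image p)) :=
    Finset.image_injective (Finset.image_injective p.injective)
  have hp : fano p = (fano id).image (Finset.image p) := by simp [image_fano]
  have hset : {C : Finset (Finset V) | IsFano C ∧ OrthogonalSTS (fano p) C} =
      ((disjointLabellings.map fano).toFinset.image (Finset.image (Finset.image p)) :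
        Finset (Finset (Finset V))) := by
    have hdis (q : Fin 7 → Fin 7) :
        DisjointSTS (fano p) (fano (p ∘ q)) ↔ Disjoint (fano id) (fano q) := by
      rw [hp, ← image_fano p q,
        ← Finset.disjoint_image (Finset.image_injective p.injective), Finset.disjoint_left]
      simp only [DisjointSTS, not_and]
    ext C
    simp only [Set.mem_ofPred_eq, Finset.coe_image, Set.mem_image, Finset.mem_coe,
      List.mem_toFinset, List.mem_map,
      exists_exists_and_eq_and, image_fano]
    constructor
    · rintro ⟨hC, hBC⟩
      obtain ⟨r, hr0, hr1, rfl⟩ := hC.exists_eq_fano (p.injective.ne h01)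
      set q := r.trans p.symm with hq
      have hpq : (r : Fin 7 → V) = p ∘ q := by ext i; simp [hq]
      rw [hB.orthogonalSTS_iff hC, hpq, hdis] at hBC
      have hq' : (q : Fin 7 → Fin 7) = ![0, 1, q 2, q 3, q 4, q 5, q 6] := by
        ext i
        fin_cases i <;> simp [hq, hr0, hr1]
      have hq0 : q 0 = 0 := by simp [hq, hr0]
      have hq1 : q 1 = 1 := by simp [hq, hr1]
      rw [hq'] at hBC
      have := fano_mem_of_disjoint (q 2) ?_ (q 3) ?_ (q 4) ?_ (q 5) ?_ (q 6) ?_ hBC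
      · obtain ⟨s, hs, hsq⟩ := List.mem_map.1 this
        refine ⟨s, hs, ?_⟩
        rw [hpq, ← image_fano, hsq, ← hq', image_fano]
      all_goals
        rw [← hq0, ← hq1]
        simp
    · rintro ⟨q, hq, rfl⟩
      have hC : IsFano (fano (p ∘ q)) := ⟨hB.1, isSteiner_fano ((Equiv.ofBijective q
        (Finite.injective_iff_bijective.1 (injective_of_mem_disjointLabellings hq))).trans p)⟩
      exact ⟨hC, (hB.orthogonalSTS_iff hC).2 ((hdis q).2
        (disjoint_of_mem_disjointLabellings hq))⟩
  rw [hset, Set.ncard_coe_finset, Finset.card_image_of_injective _ hinj,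
    card_image_fano_disjointLabellings]
end

section
/- If F is a Fano plane with point set V and S1, S2 are two distinct Fano planes on V both orthogonal to F, then there exists a permutation of V that is an automorphism of F and an isomorphism from S1 to S2. -/
/-- A permutation is an automorphism of a block set if it maps blocks to blocks. -/
def IsAutomorphism {V : Type*} [DecidableEq V] (B : Finset (Finset V)) (σ : Equiv.Perm V) : Prop :=
  ∀ b : Finset V, b.image σ ∈ B ↔ b ∈ B

/-- The collinearity relation of a Steiner triple system. -/
structure IsSteinerRel {V : Type*} (T : V → V → V → Prop) : Prop where
  swap : ∀ {x y z}, T x y z → T y x z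
  rotate : ∀ {x y z}, T x y z → T y z x
  ne : ∀ {x y z}, T x y z → x ≠ y
  unique : ∀ {x y z w}, T x y z → T x y w → z = w
  exists_third : ∀ {x y}, x ≠ y → ∃ z, T x y z

/-- The three points form a block of `B`. -/
def IsTriple {V : Type*} [DecidableEq V] (B : Finset (Finset V)) (x y z : V) : Prop :=
  ({x, y, z} : Finset V) ∈ B

theorem IsSteiner.eq_of_mem_s3 {V : Type*} [DecidableEq V] {B : Finset (Finset V)}
    (hB : IsSteiner B) {x y : V} (hxy : x ≠ y) {b b' : Finset V} (hb : b ∈ B) (hb' : b' ∈ B)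
    (hx : x ∈ b) (hy : y ∈ b) (hx' : x ∈ b') (hy' : y ∈ b') : b = b' :=
  (hB.2 x y hxy).unique ⟨hb, hx, hy⟩ ⟨hb', hx', hy'⟩

theorem IsSteiner.isSteinerRel {V : Type*} [DecidableEq V] {B : Finset (Finset V)}
    (hB : IsSteiner B) : IsSteinerRel (IsTriple B) := by
  have rotate : ∀ {x y z}, IsTriple B x y z → IsTriple B y z x := by
    intro x y z h
    have : ({y, z, x} : Finset V) = {x, y, z} := by ext; simp; tauto
    rwa [IsTriple, this]
  have ne : ∀ {x y z}, IsTriple B x y z → x ≠ y := by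
    rintro x y z h rfl
    have h3 := hB.1 _ h
    have := Finset.card_le_two (a := x) (b := z)
    simp at h3
    omega
  refine ⟨fun {x y z} h => ?_, rotate, ne, fun {x y z w} h h' => ?_, fun {x y} hxy => ?_⟩
  · rwa [IsTriple, Finset.insert_comm]
  · have heq := hB.eq_of_mem_s3 (ne h) h h' (by simp) (by simp) (by simp) (by simp)
    have hz : z ∈ ({x, y, w} : Finset V) := heq ▸ by simp
    have h1 := ne (rotate h)
    have h2 := ne (rotate (rotate h))
    simp only [Finset.mem_insert, Finset.mem_singleton] at hz
    tauto
  · obtain ⟨b, ⟨hb, hx, hy⟩, -⟩ := hB.2 x y hxy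
    obtain ⟨p, q, r, -, -, -, rfl⟩ := Finset.card_eq_three.1 (hB.1 b hb)
    have : ∃ z, ({x, y, z} : Finset V) = {p, q, r} := by
      simp only [Finset.mem_insert, Finset.mem_singleton] at hx hy
      rcases hx with rfl | rfl | rfl <;> rcases hy with rfl | rfl | rfl <;>
        first
        | exact absurd rfl hxy
        | exact ⟨p, by grind⟩
        | exact ⟨q, by grind⟩
        | exact ⟨r, by grind⟩
    obtain ⟨z, hz⟩ := this
    exact ⟨z, by rwa [IsTriple, hz]⟩

/-- A labelling of the points of a Fano plane `T` by the triangle `a, b, d` and the points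
`c, e, g, h` collinear with two others. -/
structure IsFrame {V : Type*} (T : V → V → V → Prop) (a b c d e g h : V) : Prop where
  nodup : [a, b, c, d, e, g, h].Nodup
  cover : ∀ x, x = a ∨ x = b ∨ x = c ∨ x = d ∨ x = e ∨ x = g ∨ x = h
  abc : T a b c
  ade : T a d e
  bdg : T b d g
  cdh : T c d h
  agh : T a g h
  beh : T b e h
  ceg : T c e g

theorem IsFrame.swap {V : Type*} {T : V → V → V → Prop} (hT : IsSteinerRel T)
    {a b c d e g h : V} (hf : IsFrame T a b c d e g h) : IsFrame T b a c d g e h where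
  nodup := by have := hf.nodup; grind
  cover x := by have := hf.cover x; tauto
  abc := hT.swap hf.abc
  ade := hf.bdg
  bdg := hf.ade
  cdh := hf.cdh
  agh := hf.beh
  beh := hf.agh
  ceg := hT.rotate (hT.swap hf.ceg)

theorem exists_isFrame {V : Type*} [Fintype V] (hV : Fintype.card V = 7)
    {T : V → V → V → Prop} (hT : IsSteinerRel T) {a b d : V} (hab : a ≠ b) (had : a ≠ d)
    (hbd : b ≠ d) (habd : ¬ T a b d) : ∃ c e g h, IsFrame T a b c d e g h := by
  classical
  have s := @hT.swap
  have r := @hT.rotate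
  have n := @hT.ne
  have u := @hT.unique
  obtain ⟨c, abc⟩ := hT.exists_third hab
  obtain ⟨e, ade⟩ := hT.exists_third had
  obtain ⟨g, bdg⟩ := hT.exists_third hbd
  have hcd : c ≠ d := by rintro rfl; exact habd abc
  obtain ⟨h, cdh⟩ := hT.exists_third hcd
  have nodup : [a, b, c, d, e, g, h].Nodup := by
    simp only [List.nodup_cons, List.mem_cons, List.not_mem_nil, not_or, or_false, not_false_eq_true,
      List.nodup_nil, and_true]
    refine ⟨⟨?_, ?_, ?_, ?_, ?_, ?_⟩, ⟨?_, ?_, ?_, ?_, ?_⟩, ⟨?_, ?_, ?_, ?_⟩, ⟨?_, ?_, ?_⟩,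
      ⟨?_, ?_⟩, ?_⟩ <;> rintro rfl <;> grind
  have cover : ∀ x, x = a ∨ x = b ∨ x = c ∨ x = d ∨ x = e ∨ x = g ∨ x = h := by
    intro x
    have huniv : [a, b, c, d, e, g, h].toFinset = Finset.univ :=
      Finset.eq_univ_of_card _ (by rw [List.toFinset_card_of_nodup nodup, hV]; rfl)
    have := Finset.mem_univ x
    rw [← huniv] at this
    simpa using this
  refine ⟨c, e, g, h, nodup, cover, abc, ade, bdg, cdh, ?_, ?_, ?_⟩
  · obtain ⟨z, hz⟩ := hT.exists_third (x := a) (y := g) (by grind)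
    rcases cover z with rfl | rfl | rfl | rfl | rfl | rfl | rfl <;> grind
  · obtain ⟨z, hz⟩ := hT.exists_third (x := b) (y := e) (by grind)
    rcases cover z with rfl | rfl | rfl | rfl | rfl | rfl | rfl <;> grind
  · obtain ⟨z, hz⟩ := hT.exists_third (x := c) (y := e) (by grind)
    rcases cover z with rfl | rfl | rfl | rfl | rfl | rfl | rfl <;> grind

/-- A labelling of `V` by `Fin 7` under which `F` and `S` become the cyclic Fano planes developed
from the difference sets `{0, 1, 3}` and `{0, 2, 3}`. -/
structure IsCyclicLabelling {V : Type*} (F S : V → V → V → Prop) (v : Fin 7 → V) : Prop where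
  bijective : Function.Bijective v
  left : ∀ i, F (v i) (v (i + 1)) (v (i + 3))
  right : ∀ i, S (v i) (v (i + 2)) (v (i + 3))

theorem IsFrame.isCyclicLabelling {V : Type*} {F S : V → V → V → Prop} (hF : IsSteinerRel F)
    (hS : IsSteinerRel S) (hFS : ∀ x y z, F x y z → ¬ S x y z) {a b c d e g h : V}
    (hf : IsFrame F a b c d e g h) (abd : S a b d) (ach : S a c h) :
    IsCyclicLabelling F S ![a, b, h, c, e, d, g] := by
  obtain ⟨nodup, cover, abc, ade, bdg, cdh, agh, beh, ceg⟩ := hf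
  simp only [List.nodup_cons, List.mem_cons, List.not_mem_nil, not_or, or_false, not_false_eq_true,
    List.nodup_nil, and_true] at nodup
  have s := @hS.swap
  have r := @hS.rotate
  have n := @hS.ne
  have u := @hS.unique
  have aeg : S a e g := by
    obtain ⟨z, hz⟩ := hS.exists_third (x := a) (y := e) (by grind)
    rcases cover z with rfl | rfl | rfl | rfl | rfl | rfl | rfl <;> grind
  have beh' := hFS _ _ _ beh
  have bgh : S b g h := by
    obtain ⟨z, hz⟩ := hS.exists_third (x := b) (y := h) (by grind)
    rcases cover z with rfl | rfl | rfl | rfl | rfl | rfl | rfl <;> grind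
  have bce : S b c e := by
    obtain ⟨z, hz⟩ := hS.exists_third (x := b) (y := c) (by grind)
    rcases cover z with rfl | rfl | rfl | rfl | rfl | rfl | rfl <;> grind
  have cdg : S c d g := by
    obtain ⟨z, hz⟩ := hS.exists_third (x := c) (y := d) (by grind)
    rcases cover z with rfl | rfl | rfl | rfl | rfl | rfl | rfl <;> grind
  have deh : S d e h := by
    obtain ⟨z, hz⟩ := hS.exists_third (x := d) (y := e) (by grind)
    rcases cover z with rfl | rfl | rfl | rfl | rfl | rfl | rfl <;> grind
  have s' := @hF.swap
  have r' := @hF.rotate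
  refine ⟨⟨?_, ?_⟩, ?_, ?_⟩
  · have : [a, b, h, c, e, d, g].Nodup := by
      simp only [List.nodup_cons, List.mem_cons, List.not_mem_nil, not_or, or_false,
        not_false_eq_true, List.nodup_nil, and_true]
      grind
    rw [← List.nodup_ofFn]
    simpa [List.ofFn_succ] using this
  · intro x
    rcases cover x with rfl | rfl | rfl | rfl | rfl | rfl | rfl
    exacts [⟨0, rfl⟩, ⟨1, rfl⟩, ⟨3, rfl⟩, ⟨5, rfl⟩, ⟨4, rfl⟩, ⟨6, rfl⟩, ⟨2, rfl⟩]
  · intro i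
    fin_cases i
    · change F a b c; grind
    · change F b h e; grind
    · change F h c d; grind
    · change F c e g; grind
    · change F e d a; grind
    · change F d g b; grind
    · change F g a h; grind
  · intro i
    fin_cases i
    · change S a h c; grind
    · change S b c e; grind
    · change S h e d; grind
    · change S c d g; grind
    · change S e g a; grind
    · change S d a b; grind
    · change S g b h; grind

theorem exists_isCyclicLabelling {V : Type*} [Fintype V] (hV : Fintype.card V = 7)
    {F S : V → V → V → Prop} (hF : IsSteinerRel F) (hS : IsSteinerRel S)
    (hFS : ∀ x y z, F x y z → ¬ S x y z) : ∃ v, IsCyclicLabelling F S v := by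
  obtain ⟨a, b, hab⟩ := Fintype.exists_pair_of_one_lt_card (α := V) (by omega)
  obtain ⟨d, abd⟩ := hS.exists_third hab
  have hbd := hS.ne (hS.rotate abd)
  have had := (hS.ne (hS.rotate (hS.rotate abd))).symm
  obtain ⟨c, e, g, h, hf⟩ := exists_isFrame hV hF hab had hbd fun habd => hFS _ _ _ habd abd
  by_cases ach : S a c h
  · exact ⟨_, hf.isCyclicLabelling hF hS hFS abd ach⟩
  refine ⟨_, (hf.swap hF).isCyclicLabelling hF hS hFS (hS.swap abd) ?_⟩
  obtain ⟨nodup, cover, abc, ade, bdg, cdh, agh, beh, ceg⟩ := hf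
  simp only [List.nodup_cons, List.mem_cons, List.not_mem_nil, not_or, or_false, not_false_eq_true,
    List.nodup_nil, and_true] at nodup
  have s := @hS.swap
  have r := @hS.rotate
  have n := @hS.ne
  have u := @hS.unique
  have agh' := hFS _ _ _ agh
  have cdh' := hFS _ _ _ cdh
  have ahe : S a h e := by
    obtain ⟨z, hz⟩ := hS.exists_third (x := a) (y := h) (by grind)
    rcases cover z with rfl | rfl | rfl | rfl | rfl | rfl | rfl <;> grind
  have acg : S a c g := by
    obtain ⟨z, hz⟩ := hS.exists_third (x := a) (y := c) (by grind)
    rcases cover z with rfl | rfl | rfl | rfl | rfl | rfl | rfl <;> grind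
  obtain ⟨z, hz⟩ := hS.exists_third (x := c) (y := h) (by grind)
  rcases cover z with rfl | rfl | rfl | rfl | rfl | rfl | rfl <;> grind

theorem image_mem_of_labelling {V : Type*} [DecidableEq V] {B C : Finset (Finset V)}
    (hB : IsSteiner B) {v : Fin 7 → V} {j k : Fin 7}
    (hjk : ∀ x y : Fin 7, x ≠ y → ∃ i, (x = i ∨ x = i + j ∨ x = i + k) ∧
      (y = i ∨ y = i + j ∨ y = i + k))
    (hv : Function.Surjective v) (hvB : ∀ i, IsTriple B (v i) (v (i + j)) (v (i + k)))
    {σ : Equiv.Perm V} (hσ : ∀ i, IsTriple C (σ (v i)) (σ (v (i + j))) (σ (v (i + k))))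
    {b : Finset V} (hb : b ∈ B) : b.image σ ∈ C := by
  obtain ⟨p, hp, q, hq, hpq⟩ := Finset.one_lt_card.1 (by rw [hB.1 b hb]; norm_num)
  obtain ⟨x, rfl⟩ := hv p
  obtain ⟨y, rfl⟩ := hv q
  obtain ⟨i, hx, hy⟩ := hjk x y fun h => hpq (congrArg v h)
  have heq : b = {v i, v (i + j), v (i + k)} :=
    hB.eq_of_mem_s3 hpq hb (hvB i) hp hq (by rcases hx with rfl | rfl | rfl <;> simp)
      (by rcases hy with rfl | rfl | rfl <;> simp)
  simpa [heq, Finset.image_insert, IsTriple] using hσ i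

theorem image_mem_iff_of_image_mem {V : Type*} [DecidableEq V] {B C : Finset (Finset V)}
    (hB : IsSteiner B) (hC : IsSteiner C) {σ : Equiv.Perm V} (h : ∀ b ∈ B, b.image σ ∈ C)
    (b : Finset V) : b.image σ ∈ C ↔ b ∈ B := by
  refine ⟨fun hb => ?_, h b⟩
  have h3 := hC.1 _ hb
  rw [Finset.card_image_of_injective _ σ.injective] at h3
  obtain ⟨p, hp, q, hq, hpq⟩ := Finset.one_lt_card.1 (by rw [h3]; norm_num)
  obtain ⟨b', ⟨hb', hp', hq'⟩, -⟩ := hB.2 p q hpq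
  have heq := hC.eq_of_mem_s3 (σ.injective.ne hpq) hb (h b' hb') (Finset.mem_image_of_mem _ hp)
    (Finset.mem_image_of_mem _ hq) (Finset.mem_image_of_mem _ hp') (Finset.mem_image_of_mem _ hq')
  rwa [Finset.image_injective σ.injective heq]

/-- If `S1 ≠ S2` are Fano planes orthogonal to a Fano plane `F`, some automorphism
of `F` is an isomorphism from `S1` onto `S2`. -/
theorem exists_autom_mapping_orthogonal {V : Type*} [DecidableEq V] [Fintype V]
    (F S1 S2 : Finset (Finset V)) (hF : IsFano F) (hS1 : IsFano S1) (hS2 : IsFano S2)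
    (hne : S1 ≠ S2) (h1 : OrthogonalSTS F S1) (h2 : OrthogonalSTS F S2) :
    ∃ σ : Equiv.Perm V, IsAutomorphism F σ ∧
      ∀ b : Finset V, b.image σ ∈ S2 ↔ b ∈ S1 := by
  obtain ⟨v, hv⟩ := exists_isCyclicLabelling hF.1 hF.2.isSteinerRel hS1.2.isSteinerRel
    fun _ _ _ hx hx' => h1.1 _ ⟨hx, hx'⟩
  obtain ⟨w, hw⟩ := exists_isCyclicLabelling hF.1 hF.2.isSteinerRel hS2.2.isSteinerRel
    fun _ _ _ hx hx' => h2.1 _ ⟨hx, hx'⟩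
  let σ : Equiv.Perm V :=
    (Equiv.ofBijective v hv.bijective).symm.trans (Equiv.ofBijective w hw.bijective)
  have hσ : ∀ i, σ (v i) = w i := fun i =>
    congrArg w (Equiv.ofBijective_symm_apply_apply v hv.bijective i)
  refine ⟨σ, image_mem_iff_of_image_mem hF.2 hF.2 fun b hb => ?_,
    image_mem_iff_of_image_mem hS1.2 hS2.2 fun b hb => ?_⟩
  · exact image_mem_of_labelling hF.2 (by decide) hv.bijective.surjective hv.left
      (fun i => by simpa only [hσ] using hw.left i) hb
  · exact image_mem_of_labelling hS1.2 (by decide) hv.bijective.surjective hv.right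
      (fun i => by simpa only [hσ] using hw.right i) hb
end

section
/- The group of common automorphisms of any pair of orthogonal Fano planes is isomorphic to the Frobenius group of order 21 (and in particular does not depend on the choice of the pair). -/
/-- The group of all automorphisms of a block set, as a subgroup of the
permutation group of the points. -/
def autGroup {V : Type*} [DecidableEq V] (B : Finset (Finset V)) : Subgroup (Equiv.Perm V) where
  carrier := {σ | IsAutomorphism B σ}
  one_mem' := by intro b; simp [Finset.image_id]
  mul_mem' := by
    intro σ τ hσ hτ
    intro b
    have h : Finset.image (⇑(σ * τ)) b = Finset.image ⇑σ (Finset.image ⇑τ b) := by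
      rw [Finset.image_image]; rfl
    rw [h, hσ (Finset.image ⇑τ b), hτ b]
  inv_mem' := by
    intro σ hσ
    intro b
    have h : Finset.image ⇑σ (Finset.image ⇑σ⁻¹ b) = b := by
      ext z
      simp
    have h2 := hσ (Finset.image ⇑σ⁻¹ b)
    rw [h] at h2
    exact h2.symm

/-- The permutation `x ↦ 2x` of `ZMod 7`. -/
def lam2 : Equiv.Perm (ZMod 7) :=
  ⟨fun x => 2 * x, fun x => 4 * x, by decide, by decide⟩

/-- The permutation `x ↦ x + 1` of `ZMod 7`. -/
def tau1 : Equiv.Perm (ZMod 7) :=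
  ⟨fun x => x + 1, fun x => x - 1, by decide, by decide⟩

/-- The Frobenius group of order 21, realized as the subgroup of `Perm (ZMod 7)`
generated by `x ↦ 2x` and `x ↦ x + 1`. -/
def F21 : Subgroup (Equiv.Perm (ZMod 7)) := Subgroup.closure {lam2, tau1}

section

variable {V W : Type*} [DecidableEq V] [DecidableEq W]

/-! ### Blocks of a Steiner triple system -/

theorem IsSteiner.eq_of_mem_s5 {B : Finset (Finset V)} (h : IsSteiner B) {b c : Finset V}
    (hb : b ∈ B) (hc : c ∈ B) (hbc : 1 < (b ∩ c).card) : b = c := by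
  obtain ⟨x, hx, y, hy, hxy⟩ := Finset.one_lt_card.1 hbc
  rw [Finset.mem_inter] at hx hy
  exact (h.2 x y hxy).unique ⟨hb, hx.1, hy.1⟩ ⟨hc, hx.2, hy.2⟩

theorem IsSteiner.exists_third_s5 {B : Finset (Finset V)} (h : IsSteiner B) {x y : V}
    (hxy : x ≠ y) : ∃ z, ({x, y, z} : Finset V) ∈ B := by
  obtain ⟨b, ⟨hb, hx, hy⟩, -⟩ := h.2 x y hxy
  have hsub : ({x, y} : Finset V) ⊆ b := by
    intro t ht
    rcases Finset.mem_insert.1 ht with rfl | ht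
    · exact hx
    · rwa [Finset.mem_singleton.1 ht]
  obtain ⟨z, hz⟩ : ∃ z, b \ {x, y} = {z} := by
    rw [← Finset.card_eq_one, Finset.card_sdiff_of_subset hsub, h.1 b hb, Finset.card_pair hxy]
  refine ⟨z, ?_⟩
  have : ({x, y, z} : Finset V) = b := by
    rw [← Finset.sdiff_union_of_subset hsub, hz]
    ext t
    simp only [Finset.mem_insert, Finset.mem_singleton, Finset.mem_union]
    tauto
  rwa [this]

theorem IsSteiner.ne {B : Finset (Finset V)} (h : IsSteiner B) {x y z : V}
    (hb : ({x, y, z} : Finset V) ∈ B) : x ≠ y ∧ x ≠ z ∧ y ≠ z := by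
  have hcard := h.1 _ hb
  refine ⟨?_, ?_, ?_⟩ <;> rintro rfl
  · have := Finset.card_le_two (a := x) (b := z)
    simp_all
  · have := Finset.card_le_two (a := x) (b := y)
    simp_all [Finset.pair_comm]
  · have := Finset.card_le_two (a := x) (b := y)
    simp_all

theorem IsSteiner.third_unique_s5 {B : Finset (Finset V)} (h : IsSteiner B) {x y z w : V}
    (hz : ({x, y, z} : Finset V) ∈ B) (hw : ({x, y, w} : Finset V) ∈ B) : z = w := by
  have hbc := (h.2 x y (h.ne hz).1).unique ⟨hz, by simp, by simp⟩ ⟨hw, by simp, by simp⟩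
  have hzm : z ∈ ({x, y, w} : Finset V) := hbc ▸ (by simp)
  have := h.ne hz
  simp only [Finset.mem_insert, Finset.mem_singleton] at hzm
  tauto

theorem IsSteiner.eq_of_subset_s5 {B S : Finset (Finset V)} (h : IsSteiner B) (hS : S ⊆ B)
    (hcov : ∀ x y : V, x ≠ y → ∃ b ∈ S, x ∈ b ∧ y ∈ b) : B = S := by
  refine Finset.Subset.antisymm (fun b hb => ?_) hS
  obtain ⟨x, hx, y, hy, hxy⟩ := Finset.one_lt_card.1 (show 1 < b.card by rw [h.1 b hb]; decide)
  obtain ⟨c, hc, hxc, hyc⟩ := hcov x y hxy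
  rwa [(h.2 x y hxy).unique ⟨hb, hx, hy⟩ ⟨hS hc, hxc, hyc⟩]

/-! ### Transport of block sets along a bijection -/

/-- The block set on `W` corresponding to `B` under `p : W ≃ V`. -/
def pullBlocks (p : W ≃ V) (B : Finset (Finset V)) : Finset (Finset W) :=
  B.image (Finset.image p.symm)

theorem mem_pullBlocks {p : W ≃ V} {B : Finset (Finset V)} {b : Finset W} :
    b ∈ pullBlocks p B ↔ b.image p ∈ B := by
  simp only [pullBlocks, Finset.mem_image]
  constructor
  · rintro ⟨c, hc, rfl⟩
    simpa [Finset.image_image] using hc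
  · exact fun hb => ⟨_, hb, by simp [Finset.image_image]⟩

theorem isSteiner_pullBlocks {B : Finset (Finset V)} (h : IsSteiner B) (p : W ≃ V) :
    IsSteiner (pullBlocks p B) := by
  refine ⟨fun b hb => ?_, fun x y hxy => ?_⟩
  · rw [← h.1 _ (mem_pullBlocks.1 hb), Finset.card_image_of_injective _ p.injective]
  · obtain ⟨b, ⟨hb, hx, hy⟩, hu⟩ := h.2 (p x) (p y) (p.injective.ne hxy)
    refine ⟨b.image p.symm, ⟨?_, ?_, ?_⟩, ?_⟩
    · simpa [mem_pullBlocks, Finset.image_image] using hb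
    · exact Finset.mem_image.2 ⟨_, hx, by simp⟩
    · exact Finset.mem_image.2 ⟨_, hy, by simp⟩
    · rintro c ⟨hc, hxc, hyc⟩
      rw [← hu (c.image p) ⟨mem_pullBlocks.1 hc, Finset.mem_image_of_mem _ hxc,
        Finset.mem_image_of_mem _ hyc⟩]
      simp [Finset.image_image]

theorem mem_autGroup_pullBlocks {p : W ≃ V} {B : Finset (Finset V)} {σ : Equiv.Perm V} :
    p.symm.permCongrHom σ ∈ autGroup (pullBlocks p B) ↔ σ ∈ autGroup B := by
  have key : ∀ b : Finset W,
      (b.image (p.symm.permCongrHom σ)).image p = (b.image p).image σ := by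
    intro b
    simp only [Finset.image_image]
    congr 1
    ext x
    simp [Equiv.permCongrHom]
  change (∀ b : Finset W, _) ↔ (∀ b : Finset V, _)
  simp only [mem_pullBlocks, key]
  constructor
  · intro h b
    simpa [Finset.image_image] using h (b.image p.symm)
  · exact fun h b => h _

/-- Common automorphisms are transported by a bijection of point sets. -/
def commonAutEquivPull (p : W ≃ V) (B₁ B₂ : Finset (Finset V)) :
    (autGroup B₁ ⊓ autGroup B₂ : Subgroup (Equiv.Perm V)) ≃*
      (autGroup (pullBlocks p B₁) ⊓ autGroup (pullBlocks p B₂) : Subgroup (Equiv.Perm W)) :=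
  (p.symm.permCongrHom.subgroupMap _).trans <| MulEquiv.subgroupCongr <| by
    ext τ
    obtain ⟨σ, rfl⟩ := p.symm.permCongrHom.surjective τ
    simp only [Subgroup.mem_inf, mem_autGroup_pullBlocks]
    rw [← Subgroup.mem_inf]
    exact Subgroup.mem_map_iff_mem p.symm.permCongrHom.injective

/-! ### The standard pair of disjoint Fano planes on `ZMod 7` -/

/-- The Fano plane on `ZMod 7` developed from the nonzero squares. -/
def squareBlocks : Finset (Finset (ZMod 7)) :=
  Finset.univ.image fun c => {c + 1, c + 2, c + 4}

/-- The Fano plane on `ZMod 7` developed from the nonsquares. -/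
def nonsquareBlocks : Finset (Finset (ZMod 7)) :=
  Finset.univ.image fun c => {c + 3, c + 5, c + 6}

theorem lam2_mem : lam2 ∈ autGroup squareBlocks ⊓ autGroup nonsquareBlocks := by
  constructor <;> change ∀ b : Finset (ZMod 7), _ <;> decide +kernel

theorem tau1_mem : tau1 ∈ autGroup squareBlocks ⊓ autGroup nonsquareBlocks := by
  constructor <;> change ∀ b : Finset (ZMod 7), _ <;> decide +kernel

/-- The third point of the block of `squareBlocks` through two given points. -/
def squareThird (a b : ZMod 7) : ZMod 7 :=
  if b - a ∈ ({1, 2, 4} : Finset (ZMod 7)) then a + 3 * (b - a) else a + 5 * (b - a)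

/-- The third point of the block of `nonsquareBlocks` through two given points. -/
def nonsquareThird (a b : ZMod 7) : ZMod 7 :=
  if b - a ∈ ({1, 2, 4} : Finset (ZMod 7)) then a + 5 * (b - a) else a + 3 * (b - a)

theorem eq_squareThird : ∀ a b c : ZMod 7,
    ({a, b, c} : Finset (ZMod 7)) ∈ squareBlocks → c = squareThird a b := by
  decide +kernel

theorem eq_nonsquareThird : ∀ a b c : ZMod 7,
    ({a, b, c} : Finset (ZMod 7)) ∈ nonsquareBlocks → c = nonsquareThird a b := by
  decide +kernel

theorem affine_of_mem {σ : Equiv.Perm (ZMod 7)}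
    (hσ : σ ∈ autGroup squareBlocks ⊓ autGroup nonsquareBlocks) :
    σ 1 - σ 0 ∈ ({1, 2, 4} : Finset (ZMod 7)) ∧ ∀ x, σ x = σ 0 + (σ 1 - σ 0) * x := by
  have sq : ∀ a b c : ZMod 7, ({a, b, c} : Finset (ZMod 7)) ∈ squareBlocks →
      σ c = squareThird (σ a) (σ b) := fun a b c h =>
    eq_squareThird _ _ _ (by simpa [Finset.image_insert] using (hσ.1 _).2 h)
  have ns : ∀ a b c : ZMod 7, ({a, b, c} : Finset (ZMod 7)) ∈ nonsquareBlocks →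
      σ c = nonsquareThird (σ a) (σ b) := fun a b c h =>
    eq_nonsquareThird _ _ _ (by simpa [Finset.image_insert] using (hσ.2 _).2 h)
  have h01 : σ 0 ≠ σ 1 := σ.injective.ne (by decide)
  have h3 := sq 0 1 3 (by decide)
  have h5 := ns 0 1 5 (by decide)
  have h4 := ns 1 3 4 (by decide)
  have h6 := sq 3 4 6 (by decide)
  have h2 := sq 3 5 2 (by decide)
  have h2' := ns 1 6 2 (by decide)
  have h0 := sq 4 5 0 (by decide)
  have table : ∀ s₀ s₁ : ZMod 7, s₀ ≠ s₁ → ∀ s₃, s₃ = squareThird s₀ s₁ →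
      ∀ s₅, s₅ = nonsquareThird s₀ s₁ → ∀ s₄, s₄ = nonsquareThird s₁ s₃ →
      ∀ s₆, s₆ = squareThird s₃ s₄ → ∀ s₂, s₂ = squareThird s₃ s₅ →
      s₂ = nonsquareThird s₁ s₆ → s₀ = squareThird s₄ s₅ →
      s₁ - s₀ ∈ ({1, 2, 4} : Finset (ZMod 7)) ∧ ∀ x : Fin 7,
        ![s₀, s₁, s₂, s₃, s₄, s₅, s₆] x = s₀ + (s₁ - s₀) * (show ZMod 7 from x) := by
    simp only [forall_eq]
    decide +kernel
  obtain ⟨hd, hx⟩ := table _ _ h01 _ h3 _ h5 _ h4 _ h6 _ h2 h2' h0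
  refine ⟨hd, fun x => ?_⟩
  rw [← hx x]
  fin_cases x <;> rfl

theorem mem_F21_of_affine {σ : Equiv.Perm (ZMod 7)}
    (hd : σ 1 - σ 0 ∈ ({1, 2, 4} : Finset (ZMod 7)))
    (hx : ∀ x, σ x = σ 0 + (σ 1 - σ 0) * x) : σ ∈ F21 := by
  have key : ∀ a d : ZMod 7, d ∈ ({1, 2, 4} : Finset (ZMod 7)) →
      ∃ i j : Fin 7, ∀ x, a + d * x = (tau1 ^ (i : ℕ) * lam2 ^ (j : ℕ)) x := by
    decide +kernel
  obtain ⟨i, j, hij⟩ := key (σ 0) (σ 1 - σ 0) hd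
  have : σ = tau1 ^ (i : ℕ) * lam2 ^ (j : ℕ) := Equiv.ext fun x => (hx x).trans (hij x)
  rw [this]
  exact mul_mem (pow_mem (Subgroup.subset_closure (by simp)) _)
    (pow_mem (Subgroup.subset_closure (by simp)) _)

theorem commonAut_squareBlocks_nonsquareBlocks :
    autGroup squareBlocks ⊓ autGroup nonsquareBlocks = F21 := by
  refine le_antisymm (fun σ hσ => ?_) ?_
  · exact mem_F21_of_affine (affine_of_mem hσ).1 (affine_of_mem hσ).2
  · rw [F21, Subgroup.closure_le]
    rintro σ (rfl | rfl)
    · exact lam2_mem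
    · exact tau1_mem

/-! ### Uniqueness of the pair -/

/-- If all but the points of `C` are excluded as third points of the block through `a` and `b`,
because of the known blocks `L` and the known non-blocks `N`, then the third point is in `C`. -/
theorem IsSteiner.exists_third_mem {B : Finset (Finset V)} (h : IsSteiner B)
    (L N : Finset (Finset V)) (hL : L ⊆ B) (hN : ∀ b ∈ N, b ∉ B) (a b : V) (C : Finset V)
    (hab : a ≠ b)
    (hC : ∀ w, w ∈ C ∨ ({a, b, w} : Finset V).card ≠ 3 ∨ ({a, b, w} : Finset V) ∈ N ∨
      ∃ l ∈ L, 1 < ({a, b, w} ∩ l).card ∧ {a, b, w} ≠ l) :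
    ∃ c ∈ C, {a, b, c} ∈ B := by
  obtain ⟨w, hw⟩ := h.exists_third_s5 hab
  rcases hC w with hc | hc | hc | ⟨l, hl, h1, h2⟩
  · exact ⟨w, hc, hw⟩
  · exact absurd (h.1 _ hw) hc
  · exact absurd hw (hN _ hc)
  · exact absurd (h.eq_of_mem_s5 hw (hL hl) h1) h2

theorem IsSteiner.eq_squareBlocks {B : Finset (Finset (ZMod 7))} (h : IsSteiner B)
    (hL : {{1, 2, 4}, {1, 6, 5}, {2, 6, 0}, {4, 6, 3}} ⊆ B) : B = squareBlocks := by
  have third (a b c : ZMod 7) := h.exists_third_mem _ ∅ hL (by simp) a b {c}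
  simp only [Finset.mem_singleton, exists_eq_left] at third
  have h235 := third 2 3 5 (by decide) (by decide)
  have h013 := third 0 1 3 (by decide) (by decide)
  have h450 := third 4 5 0 (by decide) (by decide)
  refine h.eq_of_subset_s5 ?_ (by decide)
  rw [show squareBlocks = {{2, 3, 5}, {0, 1, 3}, {4, 5, 0}} ∪
    {{1, 2, 4}, {1, 6, 5}, {2, 6, 0}, {4, 6, 3}} by decide]
  refine Finset.union_subset ?_ hL
  simp [Finset.insert_subset_iff, h235, h013, h450]

theorem IsSteiner.eq_nonsquareBlocks {B : Finset (Finset (ZMod 7))} (h : IsSteiner B)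
    (hdisj : ∀ b ∈ squareBlocks, b ∉ B) (hL : {{1, 2, 6}, {1, 3, 4}, {1, 0, 5}} ⊆ B) :
    B = nonsquareBlocks := by
  have h203 : {2, 0, 3} ∈ B := by
    obtain ⟨c, hc, hB⟩ := h.exists_third_mem _ _ hL hdisj 2 0 {3, 4} (by decide) (by decide)
    obtain rfl | rfl : c = 3 ∨ c = 4 := by simpa using hc
    · exact hB
    · simpa using h.exists_third_mem _ _ (Finset.insert_subset hB hL) hdisj 2 3 ∅
        (by decide) (by decide)
  have hL₁ := Finset.insert_subset h203 hL
  obtain ⟨_, hc, h245⟩ := h.exists_third_mem _ _ hL₁ hdisj 2 4 {5} (by decide) (by decide)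
  obtain rfl := Finset.mem_singleton.1 hc
  have hL₂ := Finset.insert_subset h245 hL₁
  have third (a b c : ZMod 7) := h.exists_third_mem _ _ hL₂ hdisj a b {c}
  simp only [Finset.mem_singleton, exists_eq_left] at third
  have h604 := third 6 0 4 (by decide) (by decide)
  have h635 := third 6 3 5 (by decide) (by decide)
  refine h.eq_of_subset_s5 ?_ (by decide)
  rw [show nonsquareBlocks = {{6, 0, 4}, {6, 3, 5}} ∪
    {{2, 4, 5}, {2, 0, 3}, {1, 2, 6}, {1, 3, 4}, {1, 0, 5}} by decide]
  refine Finset.union_subset ?_ hL₂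
  simp [Finset.insert_subset_iff, h604, h635]

/-- A Fano plane on `ZMod 7` disjoint from `squareBlocks` and containing `{1, 2, 6}` is
`nonsquareBlocks`, up to an automorphism of `squareBlocks`. -/
theorem IsSteiner.exists_pullBlocks_eq_nonsquareBlocks {B : Finset (Finset (ZMod 7))}
    (h : IsSteiner B) (hdisj : ∀ b ∈ squareBlocks, b ∉ B) (h126 : {1, 2, 6} ∈ B) :
    ∃ ρ : Equiv.Perm (ZMod 7), pullBlocks ρ squareBlocks = squareBlocks ∧
      pullBlocks ρ B = nonsquareBlocks := by
  have hL : {{1, 2, 6}} ⊆ B := by simpa using h126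
  obtain ⟨c, hc, h14⟩ := h.exists_third_mem _ _ hL hdisj 1 4 {0, 3, 5} (by decide) (by decide)
  have hL₁ := Finset.insert_subset h14 hL
  obtain rfl | rfl | rfl : c = 0 ∨ c = 3 ∨ c = 5 := by simpa using hc
  · obtain ⟨_, hc, h13⟩ := h.exists_third_mem _ _ hL₁ hdisj 1 3 {5} (by decide) (by decide)
    obtain rfl := Finset.mem_singleton.1 hc
    have hL₂ := Finset.insert_subset h13 hL₁
    have h205 : {2, 0, 5} ∈ B := by
      obtain ⟨c, hc, hB⟩ := h.exists_third_mem _ _ hL₂ hdisj 2 0 {3, 5} (by decide) (by decide)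
      obtain rfl | rfl : c = 3 ∨ c = 5 := by simpa using hc
      · simpa using h.exists_third_mem _ _ (Finset.insert_subset hB hL₂) hdisj 6 3 ∅
          (by decide) (by decide)
      · exact hB
    obtain ⟨_, hc, h234⟩ := h.exists_third_mem _ _ (Finset.insert_subset h205 hL₂) hdisj 2 3 {4}
      (by decide) (by decide)
    obtain rfl := Finset.mem_singleton.1 hc
    have hρ : pullBlocks (Equiv.swap 1 2 * Equiv.swap 0 5) squareBlocks = squareBlocks := by
      decide +kernel
    refine ⟨Equiv.swap 1 2 * Equiv.swap 0 5, hρ,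
      (isSteiner_pullBlocks h _).eq_nonsquareBlocks (fun b hb hb' => ?_) ?_⟩
    · rw [← hρ] at hb
      exact hdisj _ (mem_pullBlocks.1 hb) (mem_pullBlocks.1 hb')
    · simp only [Finset.insert_subset_iff, Finset.singleton_subset_iff, mem_pullBlocks]
      refine ⟨?_, ?_, ?_⟩
      · convert h126 using 1
        decide +kernel
      · convert h234 using 1
        decide +kernel
      · convert h205 using 1
        decide +kernel
  · obtain ⟨_, hc, h10⟩ := h.exists_third_mem _ _ hL₁ hdisj 1 0 {5} (by decide) (by decide)
    obtain rfl := Finset.mem_singleton.1 hc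
    refine ⟨1, by decide +kernel, ?_⟩
    have h1 : pullBlocks (1 : Equiv.Perm (ZMod 7)) B = B := by
      ext b
      simp [mem_pullBlocks]
    rw [h1]
    refine h.eq_nonsquareBlocks hdisj ?_
    have h143 : ({1, 3, 4} : Finset (ZMod 7)) ∈ B := by rwa [Finset.pair_comm 3 4]
    simp [Finset.insert_subset_iff, h126, h143, h10]
  · simpa using h.exists_third_mem _ _ hL₁ hdisj 1 0 ∅ (by decide) (by decide)

theorem exists_frame [Fintype V] {B₁ B₂ : Finset (Finset V)} (hV : Fintype.card V = 7)
    (h₁ : IsSteiner B₁) (h₂ : IsSteiner B₂) (hdisj : DisjointSTS B₁ B₂) :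
    ∃ p : ZMod 7 ≃ V, pullBlocks p B₁ = squareBlocks ∧ {1, 2, 6} ∈ pullBlocks p B₂ := by
  obtain ⟨x, y, hxy⟩ := Fintype.one_lt_card_iff.1 (show 1 < Fintype.card V by omega)
  obtain ⟨z, hz⟩ := h₂.exists_third_s5 hxy
  obtain ⟨-, hxz, hyz⟩ := h₂.ne hz
  obtain ⟨p4, h4⟩ := h₁.exists_third_s5 hxy
  obtain ⟨p5, h5⟩ := h₁.exists_third_s5 hxz
  obtain ⟨p0, h0⟩ := h₁.exists_third_s5 hyz
  have hz' : ({x, y, z} : Finset V) ∉ B₁ := fun h => hdisj _ ⟨h, hz⟩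
  have hz4 : p4 ≠ z := by rintro rfl; exact hz' h4
  obtain ⟨p3, h3⟩ := h₁.exists_third_s5 hz4
  have hsymm : ∀ a b c : V, ({a, b, c} : Finset V) ∈ B₁ →
      ({b, a, c} : Finset V) ∈ B₁ ∧ ({a, c, b} : Finset V) ∈ B₁ := by
    intro a b c h
    rw [Finset.insert_comm b a, Finset.pair_comm c b]
    exact ⟨h, h⟩
  have huniq : ∀ a b c d : V, ({a, b, c} : Finset V) ∈ B₁ → ({a, b, d} : Finset V) ∈ B₁ → c = d :=
    fun a b c d => h₁.third_unique_s5
  have hne : ∀ a b c : V, ({a, b, c} : Finset V) ∈ B₁ → a ≠ b := fun a b c h => (h₁.ne h).1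
  have hinj : Function.Injective (![p0, x, y, p3, p4, p5, z] : Fin 7 → V) := by
    have : List.Nodup [p0, x, y, p3, p4, p5, z] := by
      simp only [List.nodup_cons, List.mem_cons, not_or, List.not_mem_nil, not_false_eq_true,
        and_true, List.nodup_nil]
      generalize hR : (fun a b c : V => ({a, b, c} : Finset V) ∈ B₁) = R at *
      have e : ∀ a b c : V, (({a, b, c} : Finset V) ∈ B₁) = R a b c := by
        intros; rw [← hR]
      simp only [e] at *
      clear hR e hdisj
      refine ⟨⟨?_, ?_, ?_, ?_, ?_, ?_⟩, ⟨?_, ?_, ?_, ?_, ?_⟩, ⟨?_, ?_, ?_, ?_⟩, ⟨?_, ?_, ?_⟩,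
        ⟨?_, ?_⟩, ?_⟩ <;> grind
    rw [← List.nodup_ofFn]
    simpa [List.ofFn_succ] using this
  let p : ZMod 7 ≃ V := Equiv.ofBijective (show ZMod 7 → V from ![p0, x, y, p3, p4, p5, z])
    ((Fintype.bijective_iff_injective_and_card _).2 ⟨hinj, by rw [hV]; rfl⟩)
  have img (a b c : ZMod 7) : ({a, b, c} : Finset (ZMod 7)).image p = {p a, p b, p c} := by
    simp [Finset.image_insert]
  refine ⟨p, (isSteiner_pullBlocks h₁ p).eq_squareBlocks ?_, ?_⟩
  · simp only [Finset.insert_subset_iff, Finset.singleton_subset_iff, mem_pullBlocks, img]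
    exact ⟨h4, h5, h0, h3⟩
  · rw [mem_pullBlocks, img]
    exact hz

end

/-- The group of common automorphisms of any pair of orthogonal Fano planes is
isomorphic to the Frobenius group of order 21. -/
theorem commonAut_of_orthogonal_iso_F21 {V : Type*} [DecidableEq V] [Fintype V]
    (B1 B2 : Finset (Finset V)) (h1 : IsFano B1) (h2 : IsFano B2)
    (horth : OrthogonalSTS B1 B2) :
    Nonempty ((autGroup B1 ⊓ autGroup B2 : Subgroup (Equiv.Perm V)) ≃* F21) := by
  obtain ⟨p, hp₁, hp₂⟩ := exists_frame h1.1 h1.2 h2.2 horth.1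
  obtain ⟨ρ, hρ₁, hρ₂⟩ := (isSteiner_pullBlocks h2.2 p).exists_pullBlocks_eq_nonsquareBlocks
    (fun b hb hb' => horth.1 _ ⟨mem_pullBlocks.1 (hp₁ ▸ hb), mem_pullBlocks.1 hb'⟩) hp₂
  refine ⟨(commonAutEquivPull p B1 B2).trans <| (commonAutEquivPull ρ _ _).trans <|
    MulEquiv.subgroupCongr ?_⟩
  rw [hp₁, hρ₁, hρ₂, commonAut_squareBlocks_nonsquareBlocks]
end
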